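/- (Jones lemma for quasiregular mappings.) Let n ≥ 2 and 0 < q < n. Let f : B → ℝⁿ \ {0} be a K-quasiregular mapping in the Miniowitz class (Min) with constants C₀, α, satisfying the multiplicity condition (M) with exponent 0 ≤ a < n−1 and constant C₁. Then the measure μ defined by dμ = (‖Df(x)‖/|f(x)|)^q (1−|x|)^{q−1} dx is a Carleson measure on B, with Carleson constant depending only on n, q, K, α, a, C₀ and C₁. -/

import Mathlib

open MeasureTheory Metric Set Filter
open scoped ENNReal NNReal Topology Classical

noncomputable section

abbrev Vec (n : ℕ) := EuclideanSpace ℝ (Fin n)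

/-- The open unit ball in `ℝⁿ`. -/
def unitBall (n : ℕ) : Set (Vec n) := Metric.ball 0 1

/-- The unit sphere `S^{n-1}` in `ℝⁿ`. -/
def unitSphere (n : ℕ) : Set (Vec n) := Metric.sphere 0 1

/-- Surface measure on the unit sphere, modelled by `(n-1)`-dimensional
Hausdorff measure restricted to the sphere. -/
def sphMeasure (n : ℕ) : Measure (Vec n) := (μH[(n : ℝ) - 1]).restrict (unitSphere n)

/-- `f` is `K`-quasiregular on the unit ball. -/
def IsQR (n : ℕ) (K : ℝ) (f : Vec n → Vec n) : Prop :=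
  ContinuousOn f (unitBall n) ∧
  (∀ x ∈ unitBall n, DifferentiableAt ℝ f x) ∧
  (∀ᵐ x ∂(volume.restrict (unitBall n)),
    ‖fderiv ℝ f x‖ ^ n ≤ K * (fderiv ℝ f x).det)

/-- The conformal automorphism `T_x` of the unit ball (with `T_0 = id`). -/
def mobiusT (n : ℕ) (x : Vec n) (y : Vec n) : Vec n :=
  if x = 0 then y
  else (‖x‖ ^ 2 * ‖y - (‖x‖ ^ 2)⁻¹ • x‖ ^ 2)⁻¹ •
    ((1 - ‖x‖ ^ 2) • (y - x) - ‖y - x‖ ^ 2 • x)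

/-- The Miniowitz class (Min) with constants `C₀, α`. -/
def InMiniowitz (n : ℕ) (C₀ α : ℝ) (f : Vec n → Vec n) : Prop :=
  ∀ x ∈ unitBall n, ∀ y ∈ unitBall n,
    C₀⁻¹ * ((1 - ‖y‖) / (1 + ‖y‖)) ^ α ≤ ‖f (mobiusT n (-x) y)‖ / ‖f (mobiusT n (-x) 0)‖ ∧
    ‖f (mobiusT n (-x) y)‖ / ‖f (mobiusT n (-x) 0)‖ ≤ C₀ * ((1 + ‖y‖) / (1 - ‖y‖)) ^ α

/-- The multiplicity condition (M) with exponent `a` and constant `C₁`. -/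
def MultCond (n : ℕ) (a C₁ : ℝ) (f : Vec n → Vec n) : Prop :=
  ∀ x ∈ unitBall n, ∀ r : ℝ, 0 < r → r < 1 → ∀ y : Vec n,
    (({z ∈ Metric.ball (0 : Vec n) r | f (mobiusT n (-x) z) = y}).encard : ℝ≥0∞) ≤
      ENNReal.ofReal (C₁ / (1 - r) ^ a)

/-- The non-tangential region `Γ(ω)` with aperture parameter `κ`. -/
def ntRegion (n : ℕ) (κ : ℝ) (ω : Vec n) : Set (Vec n) :=
  {x ∈ unitBall n | ‖x - ω‖ < (1 + κ) * (1 - ‖x‖)}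

/-- The non-tangential maximal function `f*`. -/
def ntMax (n : ℕ) (κ : ℝ) (f : Vec n → Vec n) (ω : Vec n) : ℝ≥0∞ :=
  ⨆ x ∈ ntRegion n κ ω, ENNReal.ofReal ‖f x‖

/-- `f` has the non-tangential limit `L` at `ω`. -/
def HasNTLimit (n : ℕ) (κ : ℝ) (f : Vec n → Vec n) (ω L : Vec n) : Prop :=
  Filter.Tendsto f (𝓝[ntRegion n κ ω] ω) (𝓝 L)

/-- The `p`-th mean of `f` on the sphere of radius `r`. -/
def hardyMean (n : ℕ) (p : ℝ) (f : Vec n → Vec n) (r : ℝ) : ℝ≥0∞ :=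
  (sphMeasure n (unitSphere n))⁻¹ *
    ∫⁻ ω, ENNReal.ofReal (‖f (r • ω)‖ ^ p) ∂(sphMeasure n)

/-- The Hardy `H^p` norm of `f` on the unit ball. -/
def hardyNorm (n : ℕ) (p : ℝ) (f : Vec n → Vec n) : ℝ≥0∞ :=
  (⨆ r ∈ Set.Ioo (0 : ℝ) 1, hardyMean n p f r) ^ (1 / p)

/-- `f` belongs to the Hardy space `H^p`. -/
def MemHp (n : ℕ) (p : ℝ) (f : Vec n → Vec n) : Prop := hardyNorm n p f < ⊤

/-- The `L^p(σ)` norm of a boundary function on the unit sphere. -/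
def lpSphere (n : ℕ) (p : ℝ) (g : Vec n → Vec n) : ℝ≥0∞ :=
  (∫⁻ ω, ENNReal.ofReal (‖g ω‖ ^ p) ∂(sphMeasure n)) ^ (1 / p)

/-- The `L^p(σ)` norm of the non-tangential maximal function `f*`. -/
def ntMaxLp (n : ℕ) (κ p : ℝ) (f : Vec n → Vec n) : ℝ≥0∞ :=
  (∫⁻ ω, (ntMax n κ f ω) ^ p ∂(sphMeasure n)) ^ (1 / p)

/-- `μ` is a Carleson measure on the unit ball with constant `c`. -/
def IsCarleson (n : ℕ) (c : ℝ) (μ : Measure (Vec n)) : Prop :=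
  ∀ ω ∈ unitSphere n, ∀ r : ℝ, 0 < r →
    μ (unitBall n ∩ Metric.ball ω r) ≤ ENNReal.ofReal c * ENNReal.ofReal r ^ ((n : ℝ) - 1)

/-- `μ` is an `α`-Carleson measure on the unit ball with constant `γ`. -/
def IsAlphaCarleson (n : ℕ) (α γ : ℝ) (μ : Measure (Vec n)) : Prop :=
  ∀ ω ∈ unitSphere n, ∀ r : ℝ, 0 < r →
    μ (unitBall n ∩ Metric.ball ω r) ≤
      ENNReal.ofReal γ * ENNReal.ofReal r ^ (α * ((n : ℝ) - 1))

section Moebius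

variable {n : ℕ}

/-- The denominator of the Möbius map `T_x` at `y`, in expanded form. -/
def mobiusDenom (x y : Vec n) : ℝ := 1 - 2 * inner ℝ y x + ‖x‖ ^ 2 * ‖y‖ ^ 2

lemma mobiusDenom_eq (x y : Vec n) :
    mobiusDenom x y = ‖y - x‖ ^ 2 + (1 - ‖x‖ ^ 2) * (1 - ‖y‖ ^ 2) := by
  rw [mobiusDenom, norm_sub_sq_real]; ring

lemma mobiusDenom_pos {x y : Vec n} (hx : ‖x‖ < 1) (hy : ‖y‖ < 1) : 0 < mobiusDenom x y := by
  rw [mobiusDenom_eq]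
  have h1 : 0 < 1 - ‖x‖ ^ 2 := by nlinarith [norm_nonneg x]
  have h2 : 0 < 1 - ‖y‖ ^ 2 := by nlinarith [norm_nonneg y]
  positivity

lemma mobiusT_eq (x y : Vec n) :
    mobiusT n x y =
      (mobiusDenom x y)⁻¹ • ((1 - ‖x‖ ^ 2) • (y - x) - ‖y - x‖ ^ 2 • x) := by
  unfold mobiusT
  split_ifs with h
  · simp [h, mobiusDenom]
  · congr 2
    have : ‖x‖ ≠ 0 := by simpa using h
    rw [mobiusDenom, norm_sub_sq_real, inner_smul_right, norm_smul, norm_inv, norm_pow, norm_norm]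
    field_simp
    ring

lemma mobiusT_eq_add (x y : Vec n) :
    mobiusT n x y = ((1 - ‖x‖ ^ 2) / mobiusDenom x y) • y +
      (-((1 - ‖x‖ ^ 2) + ‖y - x‖ ^ 2) / mobiusDenom x y) • x := by
  rw [mobiusT_eq]
  module

lemma norm_smul_add_smul_sq (p r : ℝ) (x y : Vec n) :
    ‖p • y + r • x‖ ^ 2 = p ^ 2 * ‖y‖ ^ 2 + 2 * p * r * inner ℝ y x + r ^ 2 * ‖x‖ ^ 2 := by
  rw [norm_add_sq_real, norm_smul, norm_smul, inner_smul_left, inner_smul_right, mul_pow, mul_pow,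
    Real.norm_eq_abs, Real.norm_eq_abs, sq_abs, sq_abs]
  simp only [conj_trivial]
  ring

lemma one_sub_norm_mobiusT_sq {x y : Vec n} (hx : ‖x‖ < 1) (hy : ‖y‖ < 1) :
    1 - ‖mobiusT n x y‖ ^ 2 = (1 - ‖x‖ ^ 2) * (1 - ‖y‖ ^ 2) / mobiusDenom x y := by
  have hD := (mobiusDenom_pos hx hy).ne'
  rw [mobiusT_eq_add, norm_smul_add_smul_sq, norm_sub_sq_real]
  field_simp
  rw [mobiusDenom]
  ring

lemma mobiusT_neg_mobiusT {x y : Vec n} (hx : ‖x‖ < 1) (hy : ‖y‖ < 1) :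
    mobiusT n (-x) (mobiusT n x y) = y := by
  have hD := (mobiusDenom_pos hx hy).ne'
  have hs : 1 - ‖x‖ ^ 2 ≠ 0 := by nlinarith [norm_nonneg x]
  set p := (1 - ‖x‖ ^ 2) / mobiusDenom x y with hp
  set r := -((1 - ‖x‖ ^ 2) + ‖y - x‖ ^ 2) / mobiusDenom x y with hr
  have hz : mobiusT n x y = p • y + r • x := mobiusT_eq_add x y
  have hzx : mobiusT n x y - -x = p • y + (r + 1) • x := by rw [hz]; module
  have hden : mobiusDenom (-x) (mobiusT n x y) = (1 - ‖x‖ ^ 2) * p := by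
    rw [mobiusDenom, norm_neg, hz, norm_smul_add_smul_sq, inner_neg_right, inner_add_left,
      inner_smul_left, inner_smul_left, real_inner_self_eq_norm_sq, hp, hr, norm_sub_sq_real]
    simp only [conj_trivial]
    field_simp
    rw [mobiusDenom]
    ring
  have hcoef : (1 - ‖x‖ ^ 2) * (r + 1) +
      (p ^ 2 * ‖y‖ ^ 2 + 2 * p * (r + 1) * inner ℝ y x + (r + 1) ^ 2 * ‖x‖ ^ 2) = 0 := by
    rw [hp, hr, norm_sub_sq_real]
    field_simp
    rw [mobiusDenom]
    ring
  have hp0 : p ≠ 0 := div_ne_zero hs hD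
  rw [mobiusT_eq, hzx, hden, norm_smul_add_smul_sq, norm_neg]
  rw [show (1 - ‖x‖ ^ 2) • (p • y + (r + 1) • x) -
      (p ^ 2 * ‖y‖ ^ 2 + 2 * p * (r + 1) * inner ℝ y x + (r + 1) ^ 2 * ‖x‖ ^ 2) • -x =
      ((1 - ‖x‖ ^ 2) * p) • y + ((1 - ‖x‖ ^ 2) * (r + 1) +
      (p ^ 2 * ‖y‖ ^ 2 + 2 * p * (r + 1) * inner ℝ y x + (r + 1) ^ 2 * ‖x‖ ^ 2)) • x by module,
    hcoef, zero_smul, add_zero, smul_smul, inv_mul_cancel₀ (mul_ne_zero hs hp0), one_smul]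

lemma mobiusT_neg_zero (x : Vec n) : mobiusT n (-x) 0 = x := by
  rw [mobiusT_eq]
  simp only [mobiusDenom, norm_neg, inner_zero_left, norm_zero, zero_sub, neg_neg, sub_zero,
    mul_zero]
  norm_num
  module

lemma norm_mobiusT_lt_one {x y : Vec n} (hx : ‖x‖ < 1) (hy : ‖y‖ < 1) :
    ‖mobiusT n x y‖ < 1 := by
  have h1 : 0 < 1 - ‖x‖ ^ 2 := by nlinarith [norm_nonneg x]
  have h2 : 0 < 1 - ‖y‖ ^ 2 := by nlinarith [norm_nonneg y]
  have h3 : 0 < 1 - ‖mobiusT n x y‖ ^ 2 := by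
    rw [one_sub_norm_mobiusT_sq hx hy]
    have := mobiusDenom_pos hx hy
    positivity
  nlinarith [norm_nonneg (mobiusT n x y)]

/-- In a Carleson box of size `R` with top point `(1 - R) ω`, the hyperbolic distance to the top
point is controlled by the relative distance to the sphere. -/
lemma norm_mobiusT_lt_of_mem_box {ω y : Vec n} {R δ : ℝ} (hω : ‖ω‖ = 1) (hR : 0 < R)
    (hR1 : R ≤ 1) (hδ : 0 < δ) (hy : ‖y‖ < 1) (hyω : ‖y - ω‖ < 2 * R) (hyδ : R * δ ≤ 1 - ‖y‖) :
    ‖mobiusT n ((1 - R) • ω) y‖ < 1 - δ / 64 := by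
  set x := (1 - R) • ω with hx
  have hxn : ‖x‖ = 1 - R := by
    rw [hx, norm_smul, hω, mul_one, Real.norm_eq_abs, abs_of_nonneg (by linarith)]
  have hx1 : ‖x‖ < 1 := by linarith
  have hyx : ‖y - x‖ ≤ 3 * R := by
    have : y - x = (y - ω) + R • ω := by rw [hx]; module
    rw [this]
    refine (norm_add_le _ _).trans ?_
    rw [norm_smul, hω, mul_one, Real.norm_eq_abs, abs_of_pos hR]
    linarith
  have hy2 : 1 - ‖y‖ ≤ 2 * R := by
    have := norm_sub_norm_le ω y
    rw [hω, norm_sub_rev] at this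
    linarith
  have hD : mobiusDenom x y ≤ 17 * R ^ 2 := by
    rw [mobiusDenom_eq, hxn]
    have h1 : ‖y - x‖ ^ 2 ≤ 9 * R ^ 2 := by nlinarith [norm_nonneg (y - x)]
    have h2 : 1 - (1 - R) ^ 2 ≤ 2 * R := by nlinarith
    have h3 : 1 - ‖y‖ ^ 2 ≤ 4 * R := by nlinarith [norm_nonneg y]
    have h4 : 0 ≤ 1 - ‖y‖ ^ 2 := by nlinarith [norm_nonneg y]
    nlinarith [mul_le_mul h2 h3 h4 (by positivity)]
  have hDpos := mobiusDenom_pos hx1 hy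
  have hT := one_sub_norm_mobiusT_sq hx1 hy
  have hlow : δ / 17 ≤ 1 - ‖mobiusT n x y‖ ^ 2 := by
    rw [hT, le_div_iff₀ hDpos, hxn]
    have h2 : R ≤ 1 - (1 - R) ^ 2 := by nlinarith
    have h3 : R * δ ≤ 1 - ‖y‖ ^ 2 := by nlinarith [norm_nonneg y]
    calc δ / 17 * mobiusDenom x y ≤ δ / 17 * (17 * R ^ 2) := by gcongr
      _ = R * (R * δ) := by ring
      _ ≤ _ := by
        apply mul_le_mul h2 h3 (by positivity)
        nlinarith
  have hlt := norm_mobiusT_lt_one hx1 hy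
  nlinarith [norm_nonneg (mobiusT n x y)]

end Moebius

section Volume

open scoped Pointwise

variable {n : ℕ}

/-- The closed round cone with axis `ω` and opening `8 R`. -/
def roundCone (ω : Vec n) (R : ℝ) : Set (Vec n) := {x | ‖x - ‖x‖ • ω‖ ≤ 8 * R * ‖x‖}

lemma isClosed_roundCone (ω : Vec n) (R : ℝ) : IsClosed (roundCone ω R) :=
  isClosed_le (by fun_prop) (by fun_prop)

lemma smul_mem_roundCone_iff {ω x : Vec n} {R s : ℝ} (hs : 0 < s) :
    s • x ∈ roundCone ω R ↔ x ∈ roundCone ω R := by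
  simp only [roundCone, mem_ofPred_eq, norm_smul, Real.norm_eq_abs, abs_of_pos hs]
  rw [show s • x - (s * ‖x‖) • ω = s • (x - ‖x‖ • ω) by module, norm_smul, Real.norm_eq_abs,
    abs_of_pos hs, show 8 * R * (s * ‖x‖) = s * (8 * R * ‖x‖) by ring]
  exact mul_le_mul_iff_right₀ hs

lemma volume_roundCone_inter_ball (hn : n ≠ 0) (ω : Vec n) (R : ℝ) {s : ℝ} (hs : 0 ≤ s) :
    volume (roundCone ω R ∩ ball 0 s) =
      ENNReal.ofReal (s ^ n) * volume (roundCone ω R ∩ ball 0 1) := by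
  rcases hs.eq_or_lt with rfl | hs
  · simp [hn]
  have : roundCone ω R ∩ ball 0 s = s • (roundCone ω R ∩ ball 0 1) := by
    ext x
    rw [Set.mem_smul_set_iff_inv_smul_mem₀ hs.ne', mem_inter_iff, mem_inter_iff,
      smul_mem_roundCone_iff (inv_pos.2 hs), mem_ball_zero_iff, mem_ball_zero_iff, norm_smul,
      norm_inv, Real.norm_eq_abs, abs_of_pos hs, inv_mul_lt_iff₀ hs, mul_one]
  rw [this, Measure.addHaar_smul, abs_of_nonneg (by positivity)]
  simp

lemma volume_roundCone_shell (hn : n ≠ 0) (ω : Vec n) (R : ℝ) {s : ℝ} (hs : 0 ≤ s) (hs1 : s ≤ 1) :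
    volume (roundCone ω R ∩ (ball 0 1 \ ball 0 s)) =
      ENNReal.ofReal (1 - s ^ n) * volume (roundCone ω R ∩ ball 0 1) := by
  have hfin : volume (roundCone ω R ∩ ball 0 1) ≠ ⊤ :=
    ((measure_mono inter_subset_right).trans_lt measure_ball_lt_top).ne
  have hfin' : volume (roundCone ω R ∩ ball 0 s) ≠ ⊤ :=
    ((measure_mono inter_subset_right).trans_lt measure_ball_lt_top).ne
  rw [inter_sdiff_distrib_left, measure_sdiff (by gcongr)
    ((isClosed_roundCone ω R).measurableSet.inter measurableSet_ball).nullMeasurableSet hfin',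
    volume_roundCone_inter_ball hn ω R hs, ENNReal.ofReal_sub _ (by positivity),
    ENNReal.sub_mul (fun _ _ => hfin)]
  simp

lemma volume_roundCone_inter_unitBall_le (hn : n ≠ 0) {ω : Vec n} (hω : ‖ω‖ = 1) {R : ℝ}
    (hR : 0 < R) (hR1 : R ≤ 1) :
    ENNReal.ofReal R * volume (roundCone ω R ∩ ball 0 1) ≤
      ENNReal.ofReal ((10 * R) ^ n) * volume (ball (0 : Vec n) 1) := by
  have h1 : R ≤ 1 - (1 - R) ^ n := by
    have : (1 - R) ^ n ≤ (1 - R) ^ 1 :=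
      pow_le_pow_of_le_one (by linarith) (by linarith) (Nat.one_le_iff_ne_zero.2 hn)
    linarith
  calc ENNReal.ofReal R * volume (roundCone ω R ∩ ball 0 1)
      ≤ ENNReal.ofReal (1 - (1 - R) ^ n) * volume (roundCone ω R ∩ ball 0 1) := by gcongr
    _ = volume (roundCone ω R ∩ (ball 0 1 \ ball 0 (1 - R))) :=
        (volume_roundCone_shell hn ω R (by linarith) (by linarith)).symm
    _ ≤ volume (ball ω (10 * R)) := by
        apply measure_mono
        rintro x ⟨hx, hx1, hx2⟩
        simp only [mem_ball_zero_iff, not_lt, roundCone, mem_ofPred_eq] at hx hx1 hx2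
        rw [mem_ball_iff_norm]
        have : x - ω = (x - ‖x‖ • ω) - (1 - ‖x‖) • ω := by module
        rw [this]
        refine (norm_sub_le _ _).trans_lt ?_
        rw [norm_smul, hω, Real.norm_eq_abs, abs_of_nonneg (by linarith)]
        nlinarith
    _ = _ := by
        rw [Measure.addHaar_ball_of_pos _ _ (by positivity)]
        simp

lemma mem_roundCone_of_mem_box {ω x : Vec n} {R : ℝ} (hω : ‖ω‖ = 1)
    (hxω : ‖x - ω‖ < 2 * R) : x ∈ roundCone ω R := by
  rw [roundCone, mem_ofPred_eq]
  have h1 : ‖x - ‖x‖ • ω‖ ≤ 2 * ‖x‖ := by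
    refine (norm_sub_le _ _).trans_eq ?_
    rw [norm_smul, hω, norm_norm]; ring
  have hlow : |1 - ‖x‖| < 2 * R := by
    have := abs_norm_sub_norm_le x ω
    rw [hω, abs_sub_comm] at this
    linarith
  have h2 : ‖x - ‖x‖ • ω‖ ≤ 4 * R := by
    have : x - ‖x‖ • ω = (x - ω) + (1 - ‖x‖) • ω := by module
    rw [this]
    refine (norm_add_le _ _).trans ?_
    rw [norm_smul, hω, Real.norm_eq_abs]
    linarith
  have := (abs_lt.1 hlow).2
  rcases le_total R (1 / 4) with h | h
  · nlinarith [norm_nonneg x, norm_nonneg (x - ω)]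
  · nlinarith [norm_nonneg x]

/-- The part of the Carleson box `B ∩ B(ω, 2R)` at relative depth comparable to `δ`. -/
def boxLayer (ω : Vec n) (R δ : ℝ) : Set (Vec n) :=
  unitBall n ∩ ball ω (2 * R) ∩ {x | R * δ ≤ 1 - ‖x‖ ∧ 1 - ‖x‖ ≤ 2 * R * δ}

lemma measurableSet_boxLayer (ω : Vec n) (R δ : ℝ) : MeasurableSet (boxLayer ω R δ) := by
  refine (measurableSet_ball.inter measurableSet_ball).inter (MeasurableSet.inter ?_ ?_)
  · exact measurableSet_le measurable_const (measurable_const.sub measurable_norm)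
  · exact measurableSet_le (measurable_const.sub measurable_norm) measurable_const

lemma volume_boxLayer_le (hn : n ≠ 0) {ω : Vec n} (hω : ‖ω‖ = 1) {R δ : ℝ}
    (hR : 0 < R) (hR1 : R ≤ 1) (hδ : 0 < δ) :
    volume (boxLayer ω R δ) ≤
      ENNReal.ofReal (2 * n * 10 ^ n * (volume (ball (0 : Vec n) 1)).toReal * R ^ n * δ) := by
  set s := max 0 (1 - 2 * R * δ) with hs
  have hs0 : 0 ≤ s := le_max_left _ _
  have hs1 : s ≤ 1 := max_le zero_le_one (by nlinarith [mul_pos hR hδ])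
  have hfin : volume (ball (0 : Vec n) 1) ≠ ⊤ := measure_ball_lt_top.ne
  have hpow : 1 - s ^ n ≤ n * (2 * R * δ) := by
    have h := one_add_mul_le_pow (a := s - 1) (by linarith) n
    have hge : 1 - 2 * R * δ ≤ s := le_max_right _ _
    rw [add_sub_cancel] at h
    have : (n : ℝ) * (1 - s) ≤ n * (2 * R * δ) := by gcongr; linarith
    linarith
  calc volume (boxLayer ω R δ)
      ≤ volume (roundCone ω R ∩ (ball 0 1 \ ball 0 s)) := by
        apply measure_mono
        rintro x ⟨⟨hx, hxω⟩, hx1, hx2⟩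
        refine ⟨mem_roundCone_of_mem_box hω (mem_ball_iff_norm.1 hxω), hx, ?_⟩
        simp only [mem_ball_zero_iff, not_lt]
        exact max_le (norm_nonneg x) (by linarith)
    _ = ENNReal.ofReal (1 - s ^ n) * volume (roundCone ω R ∩ ball 0 1) :=
        volume_roundCone_shell hn ω R hs0 hs1
    _ ≤ ENNReal.ofReal (n * (2 * R * δ)) * volume (roundCone ω R ∩ ball 0 1) := by gcongr
    _ = ENNReal.ofReal (2 * n * δ) *
          (ENNReal.ofReal R * volume (roundCone ω R ∩ ball 0 1)) := by
        rw [← mul_assoc (ENNReal.ofReal _), ← ENNReal.ofReal_mul (by positivity)]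
        congr 2; ring
    _ ≤ ENNReal.ofReal (2 * n * δ) *
          (ENNReal.ofReal ((10 * R) ^ n) * volume (ball (0 : Vec n) 1)) := by
        exact mul_le_mul_right (volume_roundCone_inter_unitBall_le hn hω hR hR1) _
    _ = _ := by
        rw [← ENNReal.ofReal_toReal hfin, ← ENNReal.ofReal_mul (by positivity),
          ← ENNReal.ofReal_mul (by positivity), ENNReal.toReal_ofReal ENNReal.toReal_nonneg]
        congr 1; rw [mul_pow]; ring

end Volume

section AreaInequality

variable {E : Type*} [NormedAddCommGroup E] [NormedSpace ℝ E] [FiniteDimensional ℝ E]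
  [MeasurableSpace E] [BorelSpace E]

/-- A set on which `f` has invertible derivative decomposes into countably many measurable pieces
on which `f` is injective. -/
lemma exists_partition_injOn (f : E → E) (s : Set E) (f' : E → E →L[ℝ] E)
    (hf' : ∀ x ∈ s, HasFDerivWithinAt f (f' x) s x) (hdet : ∀ x ∈ s, (f' x).det ≠ 0) :
    ∃ t : ℕ → Set E, Pairwise (Function.onFun Disjoint t) ∧ (∀ i, MeasurableSet (t i)) ∧
      (s ⊆ ⋃ i, t i) ∧ ∀ i, InjOn f (s ∩ t i) := by
  have hr : ∀ A : E →L[ℝ] E, ∃ c : ℝ≥0, c ≠ 0 ∧ (A.det ≠ 0 →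
      ∀ u : Set E, ApproximatesLinearOn f A u c → InjOn f u) := by
    intro A
    by_cases hA : A.det = 0
    · exact ⟨1, one_ne_zero, fun h => absurd hA h⟩
    rcases subsingleton_or_nontrivial E with hE | hE
    · exact ⟨1, one_ne_zero, fun _ u _ => injOn_of_injective (fun x y _ => Subsingleton.elim x y)⟩
    let B : E ≃L[ℝ] E := A.toContinuousLinearEquivOfDetNeZero hA
    have hB : (B : E →L[ℝ] E) = A := A.coe_toContinuousLinearEquivOfDetNeZero hA
    have hpos : 0 < ‖(B.symm : E →L[ℝ] E)‖₊⁻¹ := by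
      have := B.norm_symm_pos
      exact inv_pos.2 this
    refine ⟨‖(B.symm : E →L[ℝ] E)‖₊⁻¹ / 2, (half_pos hpos).ne', fun _ u hu => ?_⟩
    rw [← hB] at hu
    exact hu.injOn (Or.inr (NNReal.half_lt_self hpos.ne'))
  choose r hr0 hr using hr
  obtain ⟨t, A, hdisj, hmeas, hcov, happ, hA⟩ :=
    exists_partition_approximatesLinearOn_of_hasFDerivWithinAt f s f' hf' r hr0
  refine ⟨t, hdisj, hmeas, hcov, fun i => ?_⟩
  rcases s.eq_empty_or_nonempty with rfl | hs
  · simp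
  obtain ⟨y, hy, hAy⟩ := hA hs i
  exact hr (A i) (hAy ▸ hdet y hy) _ (happ i)

lemma tsum_indicator_image_le_encard {α β : Type*} (f : α → β) (s : Set α) {t : ℕ → Set α}
    (ht : Pairwise (Function.onFun Disjoint t)) (y : β) :
    ∑' i, (f '' (s ∩ t i)).indicator (1 : β → ℝ≥0∞) y ≤ ({x ∈ s | f x = y}).encard := by
  refine ENNReal.tsum_le_of_sum_range_le fun N => ?_
  set F := (Finset.range N).filter fun i => y ∈ f '' (s ∩ t i) with hF
  have hsum : ∑ i ∈ Finset.range N, (f '' (s ∩ t i)).indicator (1 : β → ℝ≥0∞) y = F.card := by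
    simp only [indicator_apply, Pi.one_apply]
    rw [← Finset.sum_filter, Finset.sum_const, nsmul_one]
  have hex : ∀ i : F, ∃ x, x ∈ s ∩ t i ∧ f x = y := fun i => (Finset.mem_filter.1 i.2).2
  choose g hg hgy using hex
  have hinj : Function.Injective g := by
    intro i j hij
    by_contra hne
    have := ht (fun h => hne (Subtype.ext h))
    exact (disjoint_left.1 this) (hg i).2 (hij ▸ (hg j).2)
  have hcard : (F.card : ℕ∞) ≤ ({x ∈ s | f x = y}).encard := by
    calc (F.card : ℕ∞) = (Set.range g).encard := by
          rw [← image_univ, hinj.encard_image, encard_univ]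
          simp
      _ ≤ _ := by
          apply encard_le_encard
          rintro _ ⟨i, rfl⟩
          exact ⟨(hg i).1, hgy i⟩
  rw [hsum]
  exact_mod_cast hcard

/-- The area inequality for differentiable maps of multiplicity at most `M`. -/
lemma lintegral_abs_det_fderiv_mul_le (μ : Measure E) [μ.IsAddHaarMeasure] {f : E → E} {s : Set E}
    (hs : MeasurableSet s) (hf : ∀ x ∈ s, DifferentiableAt ℝ f x) {M : ℝ≥0∞}
    (hM : ∀ y, (({x ∈ s | f x = y}).encard : ℝ≥0∞) ≤ M) {g : E → ℝ≥0∞} (hg : Measurable g)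
    {T : Set E} (hT : MeasurableSet T) (hsT : MapsTo f s T) :
    ∫⁻ x in s, ENNReal.ofReal |(fderiv ℝ f x).det| * g (f x) ∂μ ≤ M * ∫⁻ y in T, g y ∂μ := by
  set s' := s ∩ {x | (fderiv ℝ f x).det ≠ 0} with hs'
  have hdetm : Measurable fun x => (fderiv ℝ f x).det :=
    ContinuousLinearMap.continuous_det.measurable.comp (measurable_fderiv ℝ f)
  have hdet0 : MeasurableSet {x | (fderiv ℝ f x).det ≠ 0} :=
    hdetm (measurableSet_singleton 0).compl
  have hs_meas : MeasurableSet s' := hs.inter hdet0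
  have hder : ∀ u ⊆ s, ∀ x ∈ u, HasFDerivWithinAt f (fderiv ℝ f x) u x :=
    fun u hu x hx => (hf x (hu hx)).hasFDerivAt.hasFDerivWithinAt
  have hs_sub : s' ⊆ s := inter_subset_left
  obtain ⟨t, hdisj, hmeas, hcov, hinj⟩ :=
    exists_partition_injOn f s' (fderiv ℝ f) (hder s' hs_sub) fun x hx => hx.2
  have hpm : ∀ i, MeasurableSet (s' ∩ t i) := fun i => hs_meas.inter (hmeas i)
  have hps : ∀ i, s' ∩ t i ⊆ s := fun i => inter_subset_left.trans hs_sub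
  have him : ∀ i, MeasurableSet (f '' (s' ∩ t i)) := fun i =>
    measurable_image_of_fderivWithin (hpm i) (hder _ (hps i)) (hinj i)
  have hunion : s' = ⋃ i, s' ∩ t i := by
    rw [← inter_iUnion, inter_eq_left.2 hcov]
  calc ∫⁻ x in s, ENNReal.ofReal |(fderiv ℝ f x).det| * g (f x) ∂μ
      = ∫⁻ x in s', ENNReal.ofReal |(fderiv ℝ f x).det| * g (f x) ∂μ := by
        rw [hs', inter_comm, ← setLIntegral_indicator hdet0]
        congr 1 with x
        by_cases hx : (fderiv ℝ f x).det = 0 <;> simp [hx]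
    _ ≤ ∑' i, ∫⁻ x in s' ∩ t i, ENNReal.ofReal |(fderiv ℝ f x).det| * g (f x) ∂μ := by
        conv_lhs => rw [hunion]
        exact lintegral_iUnion_le _ _
    _ = ∑' i, ∫⁻ y, (f '' (s' ∩ t i)).indicator g y ∂μ := by
        congr 1 with i
        rw [lintegral_indicator (him i),
          lintegral_image_eq_lintegral_abs_det_fderiv_mul μ (hpm i) (hder _ (hps i)) (hinj i)]
    _ = ∫⁻ y, ∑' i, (f '' (s' ∩ t i)).indicator g y ∂μ :=
        (lintegral_tsum fun i => (hg.indicator (him i)).aemeasurable).symm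
    _ ≤ ∫⁻ y, M * T.indicator g y ∂μ := by
        refine lintegral_mono fun y => ?_
        by_cases hy : y ∈ T
        · have heq : ∀ i, (f '' (s' ∩ t i)).indicator g y =
              (f '' (s' ∩ t i)).indicator (1 : E → ℝ≥0∞) y * g y := by
            intro i
            simp only [indicator_apply, Pi.one_apply]
            split_ifs <;> simp
          rw [indicator_of_mem hy]
          simp only [heq]
          rw [ENNReal.tsum_mul_right]
          gcongr
          refine (tsum_indicator_image_le_encard f s' hdisj y).trans (le_trans ?_ (hM y))
          have : ({x ∈ s' | f x = y}).encard ≤ ({x ∈ s | f x = y}).encard :=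
            encard_le_encard fun x hx => ⟨hs_sub hx.1, hx.2⟩
          exact_mod_cast this
        · have : ∀ i, (f '' (s' ∩ t i)).indicator g y = 0 := by
            intro i
            refine indicator_of_notMem (fun h => hy ?_) _
            obtain ⟨x, hx, rfl⟩ := h
            exact hsT (hps i hx)
          simp [this]
    _ = M * ∫⁻ y in T, g y ∂μ := by
        rw [lintegral_const_mul _ (hg.indicator hT), lintegral_indicator hT]

end AreaInequality

section Annulus

variable {n : ℕ}

lemma lintegral_annulus_le {m : ℝ} (hm : 0 < m) (J : ℕ) :
    ∫⁻ y in {y : Vec n | m ≤ ‖y‖ ∧ ‖y‖ < m * 2 ^ J}, ENNReal.ofReal ((‖y‖ ^ n)⁻¹) ≤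
      J * (2 ^ n * volume (ball (0 : Vec n) 1)) := by
  induction J with
  | zero =>
    have : {y : Vec n | m ≤ ‖y‖ ∧ ‖y‖ < m * 2 ^ 0} = ∅ := by
      ext y; simp
    rw [this]; simp
  | succ J ih =>
    set r := m * 2 ^ J with hr
    have hr0 : 0 < r := by positivity
    have hsub : {y : Vec n | m ≤ ‖y‖ ∧ ‖y‖ < m * 2 ^ (J + 1)} ⊆
        {y | m ≤ ‖y‖ ∧ ‖y‖ < r} ∪ {y | r ≤ ‖y‖ ∧ ‖y‖ < 2 * r} := by
      rintro y ⟨h1, h2⟩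
      rcases lt_or_ge ‖y‖ r with h | h
      · exact Or.inl ⟨h1, h⟩
      · exact Or.inr ⟨h, by rw [hr]; rw [pow_succ] at h2; linarith⟩
    have hlast : ∫⁻ y in {y : Vec n | r ≤ ‖y‖ ∧ ‖y‖ < 2 * r}, ENNReal.ofReal ((‖y‖ ^ n)⁻¹) ≤
        2 ^ n * volume (ball (0 : Vec n) 1) := by
      calc ∫⁻ y in {y : Vec n | r ≤ ‖y‖ ∧ ‖y‖ < 2 * r}, ENNReal.ofReal ((‖y‖ ^ n)⁻¹)
          ≤ ∫⁻ y in {y : Vec n | r ≤ ‖y‖ ∧ ‖y‖ < 2 * r}, ENNReal.ofReal ((r ^ n)⁻¹) := by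
            refine setLIntegral_mono measurable_const fun y hy => ?_
            have := hy.1
            gcongr
        _ = ENNReal.ofReal ((r ^ n)⁻¹) * volume {y : Vec n | r ≤ ‖y‖ ∧ ‖y‖ < 2 * r} := by
            simp
        _ ≤ ENNReal.ofReal ((r ^ n)⁻¹) * volume (ball (0 : Vec n) (2 * r)) := by
            gcongr
            intro y hy
            exact mem_ball_zero_iff.2 hy.2
        _ = _ := by
            rw [Measure.addHaar_ball_of_pos _ _ (by positivity), ← mul_assoc,
              ← ENNReal.ofReal_mul (by positivity), finrank_euclideanSpace, Fintype.card_fin,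
              mul_pow 2 r, mul_comm (2 ^ n), inv_mul_cancel_left₀ (by positivity)]
            congr 1
            rw [ENNReal.ofReal_pow (by norm_num)]
            norm_num
    calc _ ≤ _ := lintegral_mono_set hsub
      _ ≤ _ := lintegral_union_le _ _ _
      _ ≤ _ := add_le_add ih hlast
      _ = _ := by push_cast; ring

end Annulus

section Layers

variable {n : ℕ}

lemma norm_bounds_of_mem_layer {C₀ α R δ : ℝ} {f : Vec n → Vec n} {ω x : Vec n}
    (hC₀ : 1 ≤ C₀) (hα : 0 < α) (hf0 : ∀ x ∈ unitBall n, f x ≠ 0) (hMin : InMiniowitz n C₀ α f)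
    (hω : ‖ω‖ = 1) (hR : 0 < R) (hR1 : R ≤ 1) (hδ : 0 < δ) (hx : x ∈ boxLayer ω R δ) :
    ‖f ((1 - R) • ω)‖ * (C₀ * (128 / δ) ^ α)⁻¹ ≤ ‖f x‖ ∧
      ‖f x‖ ≤ ‖f ((1 - R) • ω)‖ * (C₀ * (128 / δ) ^ α) := by
  obtain ⟨⟨hxB, hxω⟩, hxδ, -⟩ := hx
  have hx1 : ‖x‖ < 1 := mem_ball_zero_iff.1 hxB
  set x₀ := (1 - R) • ω with hx₀
  have hx₀1 : ‖x₀‖ < 1 := by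
    rw [hx₀, norm_smul, hω, mul_one, Real.norm_eq_abs, abs_of_nonneg (by linarith)]
    linarith
  have hz := norm_mobiusT_lt_of_mem_box hω hR hR1 hδ hx1 (mem_ball_iff_norm.1 hxω) hxδ
  rw [← hx₀] at hz
  have hz0 := norm_nonneg (mobiusT n x₀ x)
  have hz1 := norm_mobiusT_lt_one hx₀1 hx1
  obtain ⟨h1, h2⟩ := hMin x₀ (mem_ball_zero_iff.2 hx₀1) (mobiusT n x₀ x)
    (mem_ball_zero_iff.2 hz1)
  rw [mobiusT_neg_mobiusT hx₀1 hx1, mobiusT_neg_zero] at h1 h2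
  have hfx₀ : 0 < ‖f x₀‖ := norm_pos_iff.2 (hf0 _ (mem_ball_zero_iff.2 hx₀1))
  have hQ : (1 + ‖mobiusT n x₀ x‖) / (1 - ‖mobiusT n x₀ x‖) ≤ 128 / δ := by
    rw [div_le_div_iff₀ (by linarith) hδ]
    nlinarith
  have hQ' : (128 / δ)⁻¹ ≤ (1 - ‖mobiusT n x₀ x‖) / (1 + ‖mobiusT n x₀ x‖) := by
    rw [← inv_div (1 + ‖mobiusT n x₀ x‖)]
    apply inv_anti₀ _ hQ
    apply div_pos <;> linarith
  constructor
  · rw [mul_comm, ← le_div_iff₀ hfx₀]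
    refine le_trans ?_ h1
    rw [mul_inv, ← Real.inv_rpow (by positivity)]
    gcongr
  · rw [mul_comm, ← div_le_iff₀ hfx₀]
    refine h2.trans ?_
    have : 0 ≤ (1 + ‖mobiusT n x₀ x‖) / (1 - ‖mobiusT n x₀ x‖) :=
      div_nonneg (by linarith) (by linarith)
    gcongr

lemma encard_fiber_layer_le {a C₁ R δ : ℝ} {f : Vec n → Vec n} {ω : Vec n}
    (hM : MultCond n a C₁ f) (hω : ‖ω‖ = 1) (hR : 0 < R) (hR1 : R ≤ 1) (hδ : 0 < δ)
    (hδ1 : δ ≤ 1) (y : Vec n) :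
    (({x ∈ boxLayer ω R δ | f x = y}).encard : ℝ≥0∞) ≤
      ENNReal.ofReal (C₁ / (δ / 64) ^ a) := by
  set x₀ := (1 - R) • ω with hx₀
  have hx₀1 : ‖x₀‖ < 1 := by
    rw [hx₀, norm_smul, hω, mul_one, Real.norm_eq_abs, abs_of_nonneg (by linarith)]
    linarith
  have h := hM x₀ (mem_ball_zero_iff.2 hx₀1) (1 - δ / 64) (by linarith) (by linarith) y
  rw [sub_sub_cancel] at h
  refine le_trans ?_ h
  have hinj : InjOn (mobiusT n x₀) {x ∈ boxLayer ω R δ | f x = y} := by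
    intro x hx x' hx' hxx'
    rw [← mobiusT_neg_mobiusT hx₀1 (mem_ball_zero_iff.1 hx.1.1.1), hxx',
      mobiusT_neg_mobiusT hx₀1 (mem_ball_zero_iff.1 hx'.1.1.1)]
  have : ({x ∈ boxLayer ω R δ | f x = y}).encard ≤
      ({z ∈ ball (0 : Vec n) (1 - δ / 64) | f (mobiusT n (-x₀) z) = y}).encard := by
    rw [← hinj.encard_image]
    apply encard_le_encard
    rintro _ ⟨x, ⟨⟨⟨hxB, hxω⟩, hxδ, -⟩, hxy⟩, rfl⟩
    have hx1 : ‖x‖ < 1 := mem_ball_zero_iff.1 hxB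
    refine ⟨mem_ball_zero_iff.2
      (norm_mobiusT_lt_of_mem_box hω hR hR1 hδ hx1 (mem_ball_iff_norm.1 hxω) hxδ), ?_⟩
    rw [mobiusT_neg_mobiusT hx₀1 hx1, hxy]
  exact_mod_cast this

/-- The conformal energy of `log |f|` over a layer of a Carleson box. -/
lemma lintegral_energy_layer_le {K C₀ α a C₁ R δ : ℝ} {f : Vec n → Vec n} {ω : Vec n}
    (hK : 1 ≤ K) (hC₀ : 1 ≤ C₀) (hα : 0 < α) (hQR : IsQR n K f)
    (hf0 : ∀ x ∈ unitBall n, f x ≠ 0) (hMin : InMiniowitz n C₀ α f) (hM : MultCond n a C₁ f)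
    (hω : ‖ω‖ = 1) (hR : 0 < R) (hR1 : R ≤ 1) (hδ : 0 < δ) (hδ1 : δ ≤ 1) {J : ℕ}
    (hJ : (C₀ * (128 / δ) ^ α) ^ 2 < 2 ^ J) :
    ∫⁻ x in boxLayer ω R δ, ENNReal.ofReal ((‖fderiv ℝ f x‖ / ‖f x‖) ^ n) ≤
      ENNReal.ofReal K * (ENNReal.ofReal (C₁ / (δ / 64) ^ a) *
        (J * (2 ^ n * volume (ball (0 : Vec n) 1)))) := by
  have hsub : boxLayer ω R δ ⊆ unitBall n := fun x hx => hx.1.1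
  have hms := measurableSet_boxLayer ω R δ
  set Q := C₀ * (128 / δ) ^ α with hQ
  have hQ0 : 0 < Q := by positivity
  have hx₀1 : ‖(1 - R) • ω‖ < 1 := by
    rw [norm_smul, hω, mul_one, Real.norm_eq_abs, abs_of_nonneg (by linarith)]
    linarith
  have hfx₀ : 0 < ‖f ((1 - R) • ω)‖ := norm_pos_iff.2 (hf0 _ (mem_ball_zero_iff.2 hx₀1))
  set m := ‖f ((1 - R) • ω)‖ * Q⁻¹ with hm
  have hm0 : 0 < m := by positivity
  have hmaps : MapsTo f (boxLayer ω R δ) {y | m ≤ ‖y‖ ∧ ‖y‖ < m * 2 ^ J} := by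
    intro x hx
    obtain ⟨h1, h2⟩ := norm_bounds_of_mem_layer hC₀ hα hf0 hMin hω hR hR1 hδ hx
    refine ⟨h1, h2.trans_lt ?_⟩
    rw [hm, mul_assoc]
    refine mul_lt_mul_of_pos_left ?_ hfx₀
    rwa [← hQ, lt_inv_mul_iff₀ hQ0, ← pow_two]
  have hT : MeasurableSet {y : Vec n | m ≤ ‖y‖ ∧ ‖y‖ < m * 2 ^ J} :=
    (measurableSet_le measurable_const measurable_norm).inter
      (measurableSet_lt measurable_norm measurable_const)
  have hg : Measurable fun y : Vec n => ENNReal.ofReal ((‖y‖ ^ n)⁻¹) := by fun_prop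
  calc ∫⁻ x in boxLayer ω R δ, ENNReal.ofReal ((‖fderiv ℝ f x‖ / ‖f x‖) ^ n)
      ≤ ∫⁻ x in boxLayer ω R δ, ENNReal.ofReal K *
          (ENNReal.ofReal |(fderiv ℝ f x).det| * ENNReal.ofReal ((‖f x‖ ^ n)⁻¹)) := by
        refine lintegral_mono_ae ?_
        filter_upwards [ae_restrict_of_ae_restrict_of_subset hsub hQR.2.2] with x hx
        rw [← ENNReal.ofReal_mul (abs_nonneg _), ← ENNReal.ofReal_mul (by linarith), div_pow,
          div_eq_mul_inv, ← mul_assoc]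
        gcongr
        exact hx.trans (mul_le_mul_of_nonneg_left (le_abs_self _) (by linarith))
    _ = ENNReal.ofReal K * ∫⁻ x in boxLayer ω R δ,
          ENNReal.ofReal |(fderiv ℝ f x).det| * ENNReal.ofReal ((‖f x‖ ^ n)⁻¹) :=
        lintegral_const_mul' _ _ ENNReal.ofReal_ne_top
    _ ≤ _ := by
        refine mul_le_mul_right ((lintegral_abs_det_fderiv_mul_le volume hms
          (fun x hx => hQR.2.1 x (hsub hx)) (encard_fiber_layer_le hM hω hR hR1 hδ hδ1) hg hT
          hmaps).trans (mul_le_mul_right (lintegral_annulus_le hm0 J) _)) _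

lemma rpow_le_rpow_sub_mul_pow_add {u t q : ℝ} (hu : 0 ≤ u) (ht : 0 < t) (hq0 : 0 < q)
    (hq : q < n) : u ^ q ≤ t ^ (q - n) * u ^ n + t ^ q := by
  rcases le_total u t with h | h
  · have h1 : u ^ q ≤ t ^ q := Real.rpow_le_rpow hu h hq0.le
    have : 0 ≤ t ^ (q - n) * u ^ n := by positivity
    linarith
  · have hu0 : 0 < u := ht.trans_le h
    have h1 : u ^ (q - n) ≤ t ^ (q - n) := Real.rpow_le_rpow_of_nonpos ht h (by linarith)
    have h2 : u ^ q = u ^ (q - n) * u ^ n := by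
      rw [← Real.rpow_natCast u n, ← Real.rpow_add hu0, sub_add_cancel]
    have h3 : u ^ (q - n) * u ^ n ≤ t ^ (q - n) * u ^ n := by gcongr
    have : 0 ≤ t ^ q := by positivity
    linarith

lemma rpow_sub_one_le {R δ s q : ℝ} (hR : 0 < R) (hδ : 0 < δ) (hq0 : 0 < q) (h1 : R * δ ≤ s)
    (h2 : s ≤ 2 * R * δ) : s ^ (q - 1) ≤ 2 ^ q * (R * δ) ^ (q - 1) := by
  have hRδ : 0 < R * δ := by positivity
  have hs : 0 < s := hRδ.trans_le h1
  rw [Real.rpow_sub_one hs.ne', Real.rpow_sub_one hRδ.ne', ← mul_div_assoc,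
    ← Real.mul_rpow (by norm_num) hRδ.le]
  gcongr
  linarith

lemma energy_exponent_identity {R δ q a : ℝ} (hn : n ≠ 0) (hR : 0 < R) (hδ : 0 < δ) :
    (R * δ) ^ (q - 1) * (R⁻¹ * δ ^ (-((a + 1) / n))) ^ (q - n) / δ ^ a =
      R ^ ((n : ℝ) - 1) * δ ^ (q * (1 - (a + 1) / n)) := by
  obtain ⟨ρ, rfl⟩ : ∃ ρ, Real.exp ρ = R := ⟨_, Real.exp_log hR⟩
  obtain ⟨d, rfl⟩ : ∃ d, Real.exp d = δ := ⟨_, Real.exp_log hδ⟩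
  have : (n : ℝ) ≠ 0 := by exact_mod_cast hn
  simp only [← Real.exp_neg, ← Real.exp_mul, ← Real.exp_add, ← Real.exp_sub]
  congr 1
  field_simp
  ring

lemma volume_exponent_identity {R δ q a : ℝ} (hR : 0 < R) (hδ : 0 < δ) :
    (R * δ) ^ (q - 1) * (R⁻¹ * δ ^ (-((a + 1) / n))) ^ q * (R ^ n * δ) =
      R ^ ((n : ℝ) - 1) * δ ^ (q * (1 - (a + 1) / n)) := by
  obtain ⟨ρ, rfl⟩ : ∃ ρ, Real.exp ρ = R := ⟨_, Real.exp_log hR⟩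
  obtain ⟨d, rfl⟩ : ∃ d, Real.exp d = δ := ⟨_, Real.exp_log hδ⟩
  rw [← Real.rpow_natCast (Real.exp ρ) n]
  simp only [← Real.exp_neg, ← Real.exp_mul, ← Real.exp_add]
  congr 1
  ring

/-- The constant in the estimate of the measure of one layer, with `J` the number of dyadic
annuli met by the image of the layer. -/
def layerConst (n : ℕ) (q K a C₁ : ℝ) (J : ℝ) : ℝ :=
  2 ^ q * (K * C₁ * 64 ^ a * J * 2 ^ n + 2 * n * 10 ^ n) * (volume (ball (0 : Vec n) 1)).toReal

lemma lintegral_layer_le (hn : n ≠ 0) {q K C₀ α a C₁ R δ : ℝ} {f : Vec n → Vec n} {ω : Vec n}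
    (hq0 : 0 < q) (hq : q < n) (hC₁ : 0 < C₁)
    (hK : 1 ≤ K) (hC₀ : 1 ≤ C₀) (hα : 0 < α) (hQR : IsQR n K f)
    (hf0 : ∀ x ∈ unitBall n, f x ≠ 0) (hMin : InMiniowitz n C₀ α f) (hM : MultCond n a C₁ f)
    (hω : ‖ω‖ = 1) (hR : 0 < R) (hR1 : R ≤ 1) (hδ : 0 < δ) (hδ1 : δ ≤ 1) {J : ℕ}
    (hJ : (C₀ * (128 / δ) ^ α) ^ 2 < 2 ^ J) :
    ∫⁻ x in boxLayer ω R δ,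
        ENNReal.ofReal ((‖fderiv ℝ f x‖ / ‖f x‖) ^ q * (1 - ‖x‖) ^ (q - 1)) ≤
      ENNReal.ofReal (layerConst n q K a C₁ J *
        (R ^ ((n : ℝ) - 1) * δ ^ (q * (1 - (a + 1) / n)))) := by
  set t := R⁻¹ * δ ^ (-((a + 1) / n)) with ht
  have ht0 : 0 < t := by positivity
  set w := 2 ^ q * (R * δ) ^ (q - 1) with hw
  have hw0 : 0 < w := by positivity
  set V := (volume (ball (0 : Vec n) 1)).toReal with hV
  have hV0 : 0 ≤ V := ENNReal.toReal_nonneg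
  have hVeq : volume (ball (0 : Vec n) 1) = ENNReal.ofReal V :=
    (ENNReal.ofReal_toReal measure_ball_lt_top.ne).symm
  have henergy := lintegral_energy_layer_le hK hC₀ hα hQR hf0 hMin hM hω hR hR1 hδ hδ1 hJ
  have hvol := volume_boxLayer_le hn hω hR hR1 hδ
  have hEn : ENNReal.ofReal K * (ENNReal.ofReal (C₁ / (δ / 64) ^ a) *
        (J * (2 ^ n * volume (ball (0 : Vec n) 1)))) =
      ENNReal.ofReal (K * (C₁ / (δ / 64) ^ a * (J * (2 ^ n * V)))) := by
    rw [hVeq, ENNReal.ofReal_mul (by linarith), ENNReal.ofReal_mul (by positivity),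
      ENNReal.ofReal_mul (by positivity), ENNReal.ofReal_mul (by positivity),
      ENNReal.ofReal_natCast, ENNReal.ofReal_pow (by norm_num), ENNReal.ofReal_ofNat]
  rw [hEn] at henergy
  calc _ ≤ ∫⁻ x in boxLayer ω R δ, (ENNReal.ofReal (w * t ^ (q - n)) *
          ENNReal.ofReal ((‖fderiv ℝ f x‖ / ‖f x‖) ^ n) + ENNReal.ofReal (w * t ^ q)) := by
        refine setLIntegral_mono' (measurableSet_boxLayer ω R δ) fun x hx => ?_
        rw [← ENNReal.ofReal_mul (by positivity), ← ENNReal.ofReal_add (by positivity)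
          (by positivity)]
        apply ENNReal.ofReal_le_ofReal
        have hu : 0 ≤ ‖fderiv ℝ f x‖ / ‖f x‖ := by positivity
        have h1 := rpow_le_rpow_sub_mul_pow_add hu ht0 hq0 hq
        have h2 := rpow_sub_one_le hR hδ hq0 hx.2.1 hx.2.2
        have h3 : 0 ≤ (1 - ‖x‖) ^ (q - 1) :=
          Real.rpow_nonneg ((mul_pos hR hδ).le.trans hx.2.1) _
        calc _ ≤ _ := mul_le_mul h1 h2 h3 (by positivity)
          _ = _ := by rw [← hw]; ring
    _ = ENNReal.ofReal (w * t ^ (q - n)) *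
          (∫⁻ x in boxLayer ω R δ, ENNReal.ofReal ((‖fderiv ℝ f x‖ / ‖f x‖) ^ n)) +
          ENNReal.ofReal (w * t ^ q) * volume (boxLayer ω R δ) := by
        rw [lintegral_add_right _ measurable_const, lintegral_const_mul' _ _ ENNReal.ofReal_ne_top,
          setLIntegral_const]
    _ ≤ ENNReal.ofReal (w * t ^ (q - n)) *
          ENNReal.ofReal (K * (C₁ / (δ / 64) ^ a * (J * (2 ^ n * V)))) +
          ENNReal.ofReal (w * t ^ q) * ENNReal.ofReal (2 * n * 10 ^ n * V * R ^ n * δ) := by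
        gcongr
    _ = _ := by
        have hK0 : 0 < K := by linarith
        rw [← ENNReal.ofReal_mul (by positivity), ← ENNReal.ofReal_mul (by positivity),
          ← ENNReal.ofReal_add (by positivity) (by positivity)]
        congr 1
        have e1 := energy_exponent_identity (q := q) (a := a) hn hR hδ
        have e2 := volume_exponent_identity (n := n) (q := q) (a := a) hR hδ
        rw [← ht] at e1 e2
        rw [Real.div_rpow hδ.le (by norm_num)]
        calc _ = 2 ^ q * (K * C₁ * 64 ^ a * J * 2 ^ n) * V *
                ((R * δ) ^ (q - 1) * t ^ (q - n) / δ ^ a) +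
              2 ^ q * (2 * n * 10 ^ n) * V * ((R * δ) ^ (q - 1) * t ^ q * (R ^ n * δ)) := by
                rw [hw]; field_simp
          _ = _ := by rw [e1, e2, layerConst, ← hV]; ring

/-- The Carleson box is exhausted by its dyadic layers. -/
lemma box_subset_iUnion_boxLayer {ω : Vec n} (hω : ‖ω‖ = 1) {R : ℝ} (hR : 0 < R) :
    unitBall n ∩ ball ω (2 * R) ⊆ ⋃ k : ℕ, boxLayer ω R ((1 / 2) ^ k) := by
  rintro x ⟨hx, hxω⟩
  have hx1 : ‖x‖ < 1 := mem_ball_zero_iff.1 hx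
  have hx2 : 1 - ‖x‖ < 2 * R := by
    have := norm_sub_norm_le ω x
    rw [hω, norm_sub_rev] at this
    have := mem_ball_iff_norm.1 hxω
    linarith
  obtain ⟨k, hk1, hk2⟩ := exists_nat_pow_near_of_lt_one (x := (1 - ‖x‖) / (2 * R)) (y := 1 / 2)
    (by apply div_pos <;> linarith) (by rw [div_le_one (by linarith)]; exact hx2.le)
    (by norm_num) (by norm_num)
  rw [lt_div_iff₀ (by linarith), pow_succ] at hk1
  rw [div_le_iff₀ (by linarith)] at hk2
  exact mem_iUnion.2 ⟨k, ⟨hx, hxω⟩, by linarith, by linarith⟩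

lemma exists_number_of_annuli (C₀ α : ℝ) :
    ∃ N : ℕ, ∀ k : ℕ, (C₀ * (128 / (1 / 2 : ℝ) ^ k) ^ α) ^ 2 < 2 ^ (N * (k + 1)) := by
  obtain ⟨A, hA⟩ := pow_unbounded_of_one_lt ((C₀ * 128 ^ α) ^ 2) (one_lt_two (α := ℝ))
  obtain ⟨B, hB⟩ := exists_nat_ge (2 * α)
  refine ⟨A + B, fun k => ?_⟩
  have h1 : (128 / (1 / 2 : ℝ) ^ k) ^ α = 128 ^ α * 2 ^ (k * α) := by
    rw [one_div, inv_pow, div_inv_eq_mul, Real.mul_rpow (by norm_num) (by positivity),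
      ← Real.rpow_natCast, ← Real.rpow_mul (by norm_num)]
  have h2 : ((2 : ℝ) ^ (k * α)) ^ 2 ≤ 2 ^ (B * k) := by
    rw [← Real.rpow_natCast, ← Real.rpow_natCast, ← Real.rpow_mul (by norm_num)]
    apply Real.rpow_le_rpow_of_exponent_le (by norm_num)
    push_cast
    nlinarith [(Nat.cast_nonneg k : (0 : ℝ) ≤ k)]
  rw [h1, ← mul_assoc, mul_pow]
  calc (C₀ * 128 ^ α) ^ 2 * ((2 : ℝ) ^ (k * α)) ^ 2 < 2 ^ A * 2 ^ (B * k) := by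
        apply mul_lt_mul hA h2 (by positivity) (by positivity)
    _ = 2 ^ (A + B * k) := (pow_add _ _ _).symm
    _ ≤ 2 ^ ((A + B) * (k + 1)) := by
        apply pow_le_pow_right₀ (by norm_num)
        nlinarith

end Layers

theorem jones_lemma_qr (n : ℕ) (hn : 2 ≤ n) (q K C₀ α a C₁ : ℝ)
    (hq0 : 0 < q) (hq : q < n) (hK : 1 ≤ K) (hC₀ : 1 ≤ C₀) (hα : 0 < α)
    (ha0 : 0 ≤ a) (ha : a < (n : ℝ) - 1) (hC₁ : 0 < C₁) :
    ∃ c : ℝ, 0 < c ∧ ∀ f : Vec n → Vec n,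
      IsQR n K f → (∀ x ∈ unitBall n, f x ≠ 0) →
      InMiniowitz n C₀ α f → MultCond n a C₁ f →
      IsCarleson n c ((volume.restrict (unitBall n)).withDensity
        (fun x => ENNReal.ofReal ((‖fderiv ℝ f x‖ / ‖f x‖) ^ q * (1 - ‖x‖) ^ (q - 1)))) := by
  have hn0 : n ≠ 0 := by omega
  have hnpos : (0 : ℝ) < n := by positivity
  obtain ⟨N, hN⟩ := exists_number_of_annuli C₀ α
  set η := q * (1 - (a + 1) / n) with hη
  have hη0 : 0 < η := by
    apply mul_pos hq0
    rw [sub_pos, div_lt_one hnpos]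
    linarith
  set θ : ℝ := (1 / 2) ^ η with hθ
  have hθ0 : 0 ≤ θ := by positivity
  have hθ1 : θ < 1 := Real.rpow_lt_one (by norm_num) (by norm_num) hη0
  set L := layerConst n q K a C₁ N with hL
  have hK0 : 0 < K := by linarith
  have hL0 : 0 ≤ L := by
    rw [hL, layerConst]
    positivity
  have hsum : Summable fun k : ℕ => ((k : ℝ) + 1) * θ ^ k := by
    have h1 := summable_pow_mul_geometric_of_norm_lt_one 1
      (show ‖θ‖ < 1 by rwa [Real.norm_eq_abs, abs_of_nonneg hθ0])
    have h2 := summable_geometric_of_lt_one hθ0 hθ1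
    refine (h1.add h2).congr fun k => ?_
    rw [pow_one]; ring
  set S := ∑' k : ℕ, ((k : ℝ) + 1) * θ ^ k with hS
  have hS0 : 0 ≤ S := tsum_nonneg fun k => by positivity
  refine ⟨L * S + 1, by positivity, fun f hQR hf0 hMin hM ω hω r hr => ?_⟩
  have hω1 : ‖ω‖ = 1 := by simpa [unitSphere] using hω
  set R := min r 1 with hR
  have hR0 : 0 < R := lt_min hr one_pos
  have hR1 : R ≤ 1 := min_le_right _ _
  have hbox : unitBall n ∩ ball ω r ⊆ unitBall n ∩ ball ω (2 * R) := by
    rintro x ⟨hx, hxω⟩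
    refine ⟨hx, mem_ball_iff_norm.2 ?_⟩
    have h1 : ‖x‖ < 1 := mem_ball_zero_iff.1 hx
    have h2 := mem_ball_iff_norm.1 hxω
    have h3 := norm_sub_le x ω
    rcases min_choice r 1 with h | h <;> rw [hR, h] <;> linarith
  have hmeas : MeasurableSet (unitBall n ∩ ball ω r) :=
    measurableSet_ball.inter measurableSet_ball
  set F : Vec n → ℝ≥0∞ :=
    fun x => ENNReal.ofReal ((‖fderiv ℝ f x‖ / ‖f x‖) ^ q * (1 - ‖x‖) ^ (q - 1)) with hF
  have hlayer : ∀ k : ℕ, ∫⁻ x in boxLayer ω R ((1 / 2) ^ k), F x ≤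
      ENNReal.ofReal (L * R ^ ((n : ℝ) - 1) * (((k : ℝ) + 1) * θ ^ k)) := by
    intro k
    refine (lintegral_layer_le hn0 hq0 hq hC₁ hK hC₀ hα hQR hf0 hMin hM hω1 hR0 hR1
      (by positivity) (pow_le_one₀ (by norm_num) (by norm_num)) (hN k)).trans ?_
    apply ENNReal.ofReal_le_ofReal
    have hpow : ((1 / 2 : ℝ) ^ k) ^ η = θ ^ k := by
      rw [hθ, ← Real.rpow_natCast, ← Real.rpow_natCast, ← Real.rpow_mul (by norm_num),
        ← Real.rpow_mul (by norm_num), mul_comm]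
    have hconst : layerConst n q K a C₁ ((N * (k + 1) : ℕ) : ℝ) ≤ L * (k + 1) := by
      rw [hL, layerConst, layerConst]
      push_cast
      have hk : (0 : ℝ) ≤ k := Nat.cast_nonneg k
      have : 0 ≤ 2 ^ q * (2 * n * 10 ^ n * (k : ℝ)) *
          (volume (ball (0 : Vec n) 1)).toReal := by positivity
      linarith
    rw [← hη, hpow]
    calc _ ≤ L * (k + 1) * (R ^ ((n : ℝ) - 1) * θ ^ k) := by gcongr
      _ = _ := by ring
  calc _ = ∫⁻ x in unitBall n ∩ ball ω r, F x := by
        rw [withDensity_apply _ hmeas, Measure.restrict_restrict hmeas,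
          inter_eq_left.2 inter_subset_left]
    _ ≤ ∫⁻ x in ⋃ k : ℕ, boxLayer ω R ((1 / 2) ^ k), F x :=
        lintegral_mono_set (hbox.trans (box_subset_iUnion_boxLayer hω1 hR0))
    _ ≤ ∑' k : ℕ, ∫⁻ x in boxLayer ω R ((1 / 2) ^ k), F x := lintegral_iUnion_le _ _
    _ ≤ ∑' k : ℕ, ENNReal.ofReal (L * R ^ ((n : ℝ) - 1) * (((k : ℝ) + 1) * θ ^ k)) :=
        ENNReal.tsum_le_tsum hlayer
    _ = ENNReal.ofReal (L * S * R ^ ((n : ℝ) - 1)) := by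
        rw [← ENNReal.ofReal_tsum_of_nonneg (fun k => by positivity) (hsum.mul_left _),
          tsum_mul_left, ← hS]
        congr 1; ring
    _ ≤ ENNReal.ofReal ((L * S + 1) * r ^ ((n : ℝ) - 1)) := by
        apply ENNReal.ofReal_le_ofReal
        have h1 : R ^ ((n : ℝ) - 1) ≤ r ^ ((n : ℝ) - 1) :=
          Real.rpow_le_rpow hR0.le (min_le_left _ _) (by linarith)
        gcongr
        linarith
    _ = _ := by
        rw [ENNReal.ofReal_mul (by positivity), ENNReal.ofReal_rpow_of_pos hr]

end
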